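/- Hoffman's isomorphism in the special case of the paper's bracket maps the quasishuffle to the shuffle: the linear map ρ defined on words over the extended alphabet by ρ(w) = w + Σ_u (−1/2)^r u, where the sum runs over all words u obtained from w by replacing r ≥ 1 disjoint pairs of consecutive identical stochastic letters AA by the deterministic letter Ā, satisfies ρ(u ⋈ v) = ρ(u) ⧢ ρ(v) for all words u, v. -/

import Mathlib

noncomputable def shuffle {A : Type*} : List A → List A → (List A →₀ ℝ)
  | [], v => Finsupp.single v 1
  | u@(_ :: _), [] => Finsupp.single u 1
  | a :: u, b :: v =>
      Finsupp.mapDomain (a :: ·) (shuffle u (b :: v)) +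
      Finsupp.mapDomain (b :: ·) (shuffle (a :: u) v)
  termination_by u v => u.length + v.length
  decreasing_by all_goals (simp; try omega)
/-- The quasishuffle product associated with a bracket `br` on letters (with
values in linear combinations of letters), defined recursively on words:
`∅ ⋈ w = w ⋈ ∅ = w` and
`(ℓu) ⋈ (mv) = ℓ(u ⋈ mv) + m(ℓu ⋈ v) + [ℓ,m](u ⋈ v)`. -/
noncomputable def qsh {A : Type*} (br : A → A → (A →₀ ℝ)) :
    List A → List A → (List A →₀ ℝ)
  | [], v => Finsupp.single v 1
  | u@(_ :: _), [] => Finsupp.single u 1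
  | a :: u, b :: v =>
      Finsupp.mapDomain (a :: ·) (qsh br u (b :: v)) +
      Finsupp.mapDomain (b :: ·) (qsh br (a :: u) v) +
      (br a b).sum fun k c => c • Finsupp.mapDomain (k :: ·) (qsh br u v)
  termination_by u v => u.length + v.length
  decreasing_by all_goals (simp; try omega)

/- The extended alphabet: `Da` is the set of (purely) deterministic letters `a`;
for each stochastic letter `A : S`, `Sum.inr (A, false)` is the stochastic letter
`A` and `Sum.inr (A, true)` is the associated deterministic letter `Ā`. -/

/-- The paper's bracket: `[A, A] = Ā` for stochastic letters `A`, and `[ℓ,m] = 0`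
for every other pair of letters. -/
noncomputable def brIto {Da S : Type*} [DecidableEq S] :
    (Da ⊕ S × Bool) → (Da ⊕ S × Bool) → ((Da ⊕ S × Bool) →₀ ℝ)
  | Sum.inr (a, false), Sum.inr (b, false) =>
      if a = b then Finsupp.single (Sum.inr (a, true)) 1 else 0
  | _, _ => 0

/-- Hoffman's map `ρ`: `ρ(w) = w + Σ_u (−1/2)^r u`, the sum running over all
words `u` obtained from `w` by replacing `r ≥ 1` disjoint pairs of consecutive
identical stochastic letters `AA` by the deterministic letter `Ā`. -/
noncomputable def rhoMap {Da S : Type*} [DecidableEq S] :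
    List (Da ⊕ S × Bool) → (List (Da ⊕ S × Bool) →₀ ℝ)
  | [] => Finsupp.single [] 1
  | [l] => Finsupp.single [l] 1
  | l :: m :: u =>
      Finsupp.mapDomain (l :: ·) (rhoMap (m :: u)) +
      (match l, m with
       | Sum.inr (a, false), Sum.inr (b, false) =>
          if a = b then
            (-(1 : ℝ) / 2) • Finsupp.mapDomain ((Sum.inr (a, true) : Da ⊕ S × Bool) :: ·) (rhoMap u)
          else 0
       | _, _ => 0)

/-- Linear extension of `ρ` to `R⟨Ā⟩`. -/
noncomputable def rhoExt {Da S : Type*} [DecidableEq S]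
    (p : List (Da ⊕ S × Bool) →₀ ℝ) : List (Da ⊕ S × Bool) →₀ ℝ :=
  p.sum fun w c => c • rhoMap w

/-- Bilinear extension of the shuffle product. -/
noncomputable def shuffleExt {A : Type*} (p q : List A →₀ ℝ) : List A →₀ ℝ :=
  p.sum fun u c => q.sum fun v d => (c * d) • shuffle u v

/-- Concatenation of a linear combination of letters with a linear combination of words. -/
noncomputable def consLin {A : Type*} : (A →₀ ℝ) →ₗ[ℝ] (List A →₀ ℝ) →ₗ[ℝ] (List A →₀ ℝ) :=
  Finsupp.linearCombination ℝ fun a => Finsupp.lmapDomain ℝ ℝ (a :: ·)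

theorem consLin_single {A : Type*} (a : A) (x : List A →₀ ℝ) :
    consLin (Finsupp.single a 1) x = Finsupp.mapDomain (a :: ·) x := by
  simp [consLin]

theorem consLin_single_single {A : Type*} (a : A) (w : List A) :
    consLin (Finsupp.single a 1) (Finsupp.single w 1) = Finsupp.single (a :: w) 1 := by
  simp [consLin_single]

theorem sum_smul_mapDomain_cons {A : Type*} (p : A →₀ ℝ) (x : List A →₀ ℝ) :
    (p.sum fun k c => c • Finsupp.mapDomain (k :: ·) x) = consLin p x := by
  simp [consLin, Finsupp.linearCombination_apply, Finsupp.sum, LinearMap.sum_apply]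

/-- The shuffle product as a bilinear map. -/
noncomputable def shuffleLin {A : Type*} :
    (List A →₀ ℝ) →ₗ[ℝ] (List A →₀ ℝ) →ₗ[ℝ] (List A →₀ ℝ) :=
  Finsupp.linearCombination ℝ fun u => Finsupp.linearCombination ℝ fun v => shuffle u v

theorem shuffleExt_eq {A : Type*} (p q : List A →₀ ℝ) : shuffleExt p q = shuffleLin p q := by
  simp [shuffleExt, shuffleLin, Finsupp.linearCombination_apply, Finsupp.sum,
    LinearMap.sum_apply, Finset.smul_sum, mul_smul]

theorem shuffleLin_single {A : Type*} (u v : List A) :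
    shuffleLin (Finsupp.single u 1) (Finsupp.single v 1) = shuffle u v := by
  simp [shuffleLin]

theorem shuffle_nil_right {A : Type*} (u : List A) : shuffle u [] = Finsupp.single u 1 := by
  cases u <;> simp [shuffle]

theorem shuffleLin_nil_left {A : Type*} (x : List A →₀ ℝ) :
    shuffleLin (Finsupp.single [] 1) x = x := by
  have h : shuffleLin (Finsupp.single ([] : List A) 1) = LinearMap.id := by
    ext1 v
    ext1
    simp [shuffleLin_single, shuffle]
  rw [h, LinearMap.id_apply]

theorem shuffleLin_nil_right {A : Type*} (x : List A →₀ ℝ) :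
    shuffleLin x (Finsupp.single [] 1) = x := by
  have h : shuffleLin.flip (Finsupp.single ([] : List A) 1) = LinearMap.id := by
    ext1 v
    ext1
    simp [shuffleLin_single, shuffle_nil_right]
  rw [← LinearMap.flip_apply, h, LinearMap.id_apply]

theorem shuffleLin_consLin {A : Type*} (p q : A →₀ ℝ) (x y : List A →₀ ℝ) :
    shuffleLin (consLin p x) (consLin q y) =
      consLin p (shuffleLin x (consLin q y)) + consLin q (shuffleLin (consLin p x) y) := by
  induction p using Finsupp.induction_linear with
  | zero => simp
  | add p p' hp hp' => simp only [map_add, LinearMap.add_apply, hp, hp']; abel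
  | single a c =>
  induction q using Finsupp.induction_linear with
  | zero => simp
  | add q q' hq hq' => simp only [map_add, LinearMap.add_apply, hq, hq']; abel
  | single b d =>
  induction x using Finsupp.induction_linear with
  | zero => simp
  | add x x' hx hx' => simp only [map_add, LinearMap.add_apply, hx, hx']; abel
  | single u r =>
  induction y using Finsupp.induction_linear with
  | zero => simp
  | add y y' hy hy' => simp only [map_add, hy, hy']; abel
  | single v s =>
  rw [← mul_one c, ← mul_one d, ← mul_one r, ← mul_one s]
  simp only [← smul_eq_mul, ← Finsupp.smul_single, map_smul, LinearMap.smul_apply,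
    consLin_single_single, shuffleLin_single]
  rw [shuffle, ← consLin_single, ← consLin_single]
  module

theorem qsh_nil_right {A : Type*} (br : A → A → (A →₀ ℝ)) (u : List A) :
    qsh br u [] = Finsupp.single u 1 := by
  cases u <;> simp [qsh]

theorem qsh_cons_cons {A : Type*} (br : A → A → (A →₀ ℝ)) (a b : A) (u v : List A) :
    qsh br (a :: u) (b :: v) =
      consLin (Finsupp.single a 1) (qsh br u (b :: v)) +
      consLin (Finsupp.single b 1) (qsh br (a :: u) v) + consLin (br a b) (qsh br u v) := by
  rw [qsh, sum_smul_mapDomain_cons, consLin_single, consLin_single]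

section Ito

variable {Da S : Type*} [DecidableEq S]

theorem brIto_comm (a b : Da ⊕ S × Bool) : brIto a b = brIto b a := by
  rcases a with a | ⟨a, _ | _⟩ <;> rcases b with b | ⟨b, _ | _⟩ <;> simp only [brIto]
  by_cases h : a = b
  · simp [h]
  · simp [h, Ne.symm h]

/-- A bracket is either zero or a letter which itself has zero bracket with every letter. -/
theorem brIto_eq_zero_or (a b : Da ⊕ S × Bool) :
    brIto a b = 0 ∨ ∃ k : Da ⊕ S × Bool,
      brIto a b = Finsupp.single k 1 ∧ ∀ l : Da ⊕ S × Bool, brIto k l = 0 := by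
  rcases a with a | ⟨a, _ | _⟩ <;> rcases b with b | ⟨b, _ | _⟩ <;> simp only [brIto, true_or]
  by_cases h : a = b
  · exact Or.inr ⟨Sum.inr (a, true), by simp [h], fun l => rfl⟩
  · simp [h]

/-- The linear extension of `ρ`, as a linear map. -/
noncomputable def rhoLin : (List (Da ⊕ S × Bool) →₀ ℝ) →ₗ[ℝ] (List (Da ⊕ S × Bool) →₀ ℝ) :=
  Finsupp.linearCombination ℝ rhoMap

theorem rhoExt_eq (p : List (Da ⊕ S × Bool) →₀ ℝ) : rhoExt p = rhoLin p := by
  simp [rhoExt, rhoLin, Finsupp.linearCombination_apply]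

theorem rhoLin_single (w : List (Da ⊕ S × Bool)) :
    rhoLin (Finsupp.single w 1) = rhoMap w := by
  simp [rhoLin]

/-- On a word `m :: u`, the word combination `[l, m] ρ(u)`; on the empty word, zero. -/
noncomputable def bracketHead (l : Da ⊕ S × Bool) :
    List (Da ⊕ S × Bool) → (List (Da ⊕ S × Bool) →₀ ℝ)
  | [] => 0
  | m :: u => consLin (brIto l m) (rhoMap u)

/-- The linear extension of `bracketHead`. -/
noncomputable def bracketHeadLin (l : Da ⊕ S × Bool) :
    (List (Da ⊕ S × Bool) →₀ ℝ) →ₗ[ℝ] (List (Da ⊕ S × Bool) →₀ ℝ) :=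
  Finsupp.linearCombination ℝ (bracketHead l)

theorem bracketHeadLin_single (l : Da ⊕ S × Bool) (w : List (Da ⊕ S × Bool)) :
    bracketHeadLin l (Finsupp.single w 1) = bracketHead l w := by
  simp [bracketHeadLin]

theorem rhoMap_cons (l : Da ⊕ S × Bool) (w : List (Da ⊕ S × Bool)) :
    rhoMap (l :: w) =
      consLin (Finsupp.single l 1) (rhoMap w) - (1 / 2 : ℝ) • bracketHead l w := by
  cases w with
  | nil => simp [rhoMap, bracketHead, consLin_single]
  | cons m u =>
    rcases l with a | ⟨a, _ | _⟩ <;> rcases m with b | ⟨b, _ | _⟩ <;>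
      simp only [rhoMap, bracketHead, brIto, map_zero, LinearMap.zero_apply, smul_zero, sub_zero,
        add_zero, consLin_single]
    by_cases h : a = b
    · simp only [h, if_true, consLin_single]
      module
    · simp [h]

theorem rhoLin_consLin_single (l : Da ⊕ S × Bool) (x : List (Da ⊕ S × Bool) →₀ ℝ) :
    rhoLin (consLin (Finsupp.single l 1) x) =
      consLin (Finsupp.single l 1) (rhoLin x) - (1 / 2 : ℝ) • bracketHeadLin l x := by
  induction x using Finsupp.induction_linear with
  | zero => simp
  | add x y hx hy => simp only [map_add, hx, hy]; module
  | single w c =>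
    rw [← mul_one c]
    simp only [← smul_eq_mul, ← Finsupp.smul_single, map_smul, consLin_single_single,
      rhoLin_single, bracketHeadLin_single, rhoMap_cons]
    module

theorem bracketHeadLin_consLin_single (l m : Da ⊕ S × Bool) (x : List (Da ⊕ S × Bool) →₀ ℝ) :
    bracketHeadLin l (consLin (Finsupp.single m 1) x) = consLin (brIto l m) (rhoLin x) := by
  induction x using Finsupp.induction_linear with
  | zero => simp
  | add x y hx hy => simp only [map_add, hx, hy]
  | single w c =>
    rw [← mul_one c]
    simp only [← smul_eq_mul, ← Finsupp.smul_single, map_smul, consLin_single_single,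
      rhoLin_single, bracketHeadLin_single, bracketHead]

theorem bracketHeadLin_consLin_brIto (l a b : Da ⊕ S × Bool)
    (x : List (Da ⊕ S × Bool) →₀ ℝ) : bracketHeadLin l (consLin (brIto a b) x) = 0 := by
  rcases brIto_eq_zero_or a b with h | ⟨k, h, hk⟩
  · simp [h]
  · rw [h, bracketHeadLin_consLin_single, brIto_comm, hk]
    simp

theorem bracketHeadLin_eq_zero {k : Da ⊕ S × Bool} (hk : ∀ l : Da ⊕ S × Bool, brIto k l = 0)
    (x : List (Da ⊕ S × Bool) →₀ ℝ) : bracketHeadLin k x = 0 := by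
  have h : bracketHead k = 0 := by
    ext1 w
    cases w <;> simp [bracketHead, hk]
  simp [bracketHeadLin, h]

theorem rhoLin_consLin_brIto (a b : Da ⊕ S × Bool) (x : List (Da ⊕ S × Bool) →₀ ℝ) :
    rhoLin (consLin (brIto a b) x) = consLin (brIto a b) (rhoLin x) := by
  rcases brIto_eq_zero_or a b with h | ⟨k, h, hk⟩
  · simp [h]
  · rw [h, rhoLin_consLin_single, bracketHeadLin_eq_zero hk]
    simp

theorem bracketHeadLin_qsh_cons_right (a b : Da ⊕ S × Bool) (u v : List (Da ⊕ S × Bool))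
    (ih : ∀ u' : List (Da ⊕ S × Bool), u'.length < u.length →
      rhoLin (qsh brIto u' (b :: v)) = shuffleLin (rhoMap u') (rhoMap (b :: v))) :
    ∃ p x, bracketHead a u = consLin p x ∧
      bracketHeadLin a (qsh brIto u (b :: v)) =
        consLin (brIto a b) (rhoLin (qsh brIto u v)) +
          consLin p (shuffleLin x (rhoMap (b :: v))) := by
  cases u with
  | nil =>
    refine ⟨0, 0, by simp [bracketHead], ?_⟩
    simp [qsh, bracketHeadLin_single, bracketHead, rhoLin_single]
  | cons c u =>
    refine ⟨brIto a c, rhoMap u, rfl, ?_⟩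
    rw [qsh_cons_cons, map_add, map_add, bracketHeadLin_consLin_single,
      bracketHeadLin_consLin_single, bracketHeadLin_consLin_brIto, ih u (by simp)]
    abel

theorem bracketHeadLin_qsh_cons_left (a b : Da ⊕ S × Bool) (u v : List (Da ⊕ S × Bool))
    (ih : ∀ v' : List (Da ⊕ S × Bool), v'.length < v.length →
      rhoLin (qsh brIto (a :: u) v') = shuffleLin (rhoMap (a :: u)) (rhoMap v')) :
    ∃ q y, bracketHead b v = consLin q y ∧
      bracketHeadLin b (qsh brIto (a :: u) v) =
        consLin (brIto a b) (rhoLin (qsh brIto u v)) +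
          consLin q (shuffleLin (rhoMap (a :: u)) y) := by
  cases v with
  | nil =>
    refine ⟨0, 0, by simp [bracketHead], ?_⟩
    simp [qsh_nil_right, bracketHeadLin_single, bracketHead, rhoLin_single, brIto_comm a b]
  | cons d v =>
    refine ⟨brIto b d, rhoMap v, rfl, ?_⟩
    rw [qsh_cons_cons, map_add, map_add, bracketHeadLin_consLin_single,
      bracketHeadLin_consLin_single, bracketHeadLin_consLin_brIto, ih v (by simp),
      brIto_comm b a]
    abel

theorem rhoLin_qsh (u v : List (Da ⊕ S × Bool)) :
    rhoLin (qsh brIto u v) = shuffleLin (rhoMap u) (rhoMap v) := by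
  induction hn : u.length + v.length using Nat.strong_induction_on generalizing u v with
  | _ n ih =>
  cases u with
  | nil => simp [qsh, rhoLin_single, rhoMap, shuffleLin_nil_left]
  | cons a u =>
  cases v with
  | nil => simp [qsh_nil_right, rhoLin_single, rhoMap, shuffleLin_nil_right]
  | cons b v =>
  simp only [List.length_cons] at hn
  obtain ⟨p, x, hp, hpx⟩ := bracketHeadLin_qsh_cons_right a b u v fun u' hu' =>
    ih _ (by simp only [List.length_cons]; omega) u' (b :: v) rfl
  obtain ⟨q, y, hq, hqy⟩ := bracketHeadLin_qsh_cons_left a b u v fun v' hv' =>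
    ih _ (by simp only [List.length_cons]; omega) (a :: u) v' rfl
  rw [qsh_cons_cons, map_add, map_add, rhoLin_consLin_single, rhoLin_consLin_single,
    rhoLin_consLin_brIto, hpx, hqy,
    ih _ (by simp only [List.length_cons]; omega) u (b :: v) rfl,
    ih _ (by simp only [List.length_cons]; omega) (a :: u) v rfl,
    rhoMap_cons a, rhoMap_cons b, hp, hq]
  simp only [map_sub, map_smul, LinearMap.sub_apply, LinearMap.smul_apply, shuffleLin_consLin]
  module

end Ito

/-- Hoffman's isomorphism for the paper's bracket maps the
quasishuffle to the shuffle: `ρ(u ⋈ v) = ρ(u) ⧢ ρ(v)` for all words `u, v` over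
the extended alphabet. -/
theorem rho_quasishuffle_to_shuffle {Da S : Type*} [DecidableEq S]
    (u v : List (Da ⊕ S × Bool)) :
    rhoExt (qsh brIto u v) = shuffleExt (rhoMap u) (rhoMap v) := by
  rw [rhoExt_eq, shuffleExt_eq, rhoLin_qsh]
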